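/- Let D be a •/◦/+-diagram in which stones are colored black iff they are uncrossings, and let D' be obtained from D by performing a corrective flip. Then u_{b^in}^D ≥ u_{b^in}^{D'} in the Bruhat order on S_n for every box b of the shared Ferrers shape. -/

import Mathlib

namespace GoPaper

/-- Fillings of a box: black stone, white stone, or plus. -/
inductive Fill : Type
  | black | white | plus
deriving DecidableEq

/-- A Ferrers shape inside the `k × (n-k)` rectangle (rows indexed from the top by
`0,…,k-1`, columns from the left by `0,…,n-k-1`), given by its set of boxes,
which is closed to the northwest. -/
structure Shape (n k : ℕ) where
  boxes : Finset (ℕ × ℕ)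
  row_lt : ∀ b ∈ boxes, b.1 < k
  col_lt : ∀ b ∈ boxes, b.2 < n - k
  nw_closed : ∀ b ∈ boxes, ∀ r c : ℕ, r ≤ b.1 → c ≤ b.2 → (r, c) ∈ boxes

/-- A `•/◦/+`-diagram: a Ferrers shape together with a filling of its boxes. -/
structure Diagram (n k : ℕ) where
  S : Shape n k
  fill : ℕ × ℕ → Fill

/-- `inIn b c` means `c ∈ b^in`, i.e. `c` is weakly to the right of and weakly below `b`. -/
def inIn (b c : ℕ × ℕ) : Prop := b.1 ≤ c.1 ∧ b.2 ≤ c.2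

instance (b c : ℕ × ℕ) : Decidable (inIn b c) := by unfold inIn; infer_instance

/-- The simple transposition `s_i` (0-indexed), as a permutation of `ℕ`. -/
def sw (i : ℕ) : Equiv.Perm ℕ := Equiv.swap i (i + 1)

/-- The (0-indexed) index of the simple transposition labelling box `b`:
the top-left box `(0,0)` is labelled `n-k-1`, indices decrease to the right and
increase downward. -/
def lab (n k : ℕ) (b : ℕ × ℕ) : ℕ := n - k - 1 + b.1 - b.2

/-- The simple transposition labelling box `b`. -/
def sbox (n k : ℕ) (b : ℕ × ℕ) : Equiv.Perm ℕ := sw (lab n k b)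

/-- Coxeter length of a permutation of `S_n` (supported on `{0,…,n-1}`): the
number of inversions. -/
def len (n : ℕ) (π : Equiv.Perm ℕ) : ℕ :=
  ((Finset.range n ×ˢ Finset.range n).filter (fun p => p.1 < p.2 ∧ π p.2 < π p.1)).card

/-- A canonical reading order on the boxes of a shape: rows from bottom to top,
each row from right to left (a valid reading order; all notions read off in a
reading order are independent of its choice). -/
def readingList {n k : ℕ} (S : Shape n k) : List (ℕ × ℕ) :=
  (((List.range k).reverse).flatMap fun r =>
      ((List.range (n - k)).reverse).map fun c => (r, c)).filter
    (fun b => decide (b ∈ S.boxes))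

/-- Product, in the reading order, of the box transpositions over boxes satisfying `p`. -/
def readProd {n k : ℕ} (D : Diagram n k) (p : ℕ × ℕ → Bool) : Equiv.Perm ℕ :=
  (((readingList D.S).filter p).map fun b => sbox n k b).prod

/-- The permutation `u` of the pipe dream of `D`: product of labels of the stone boxes. -/
def permU {n k : ℕ} (D : Diagram n k) : Equiv.Perm ℕ :=
  readProd D (fun b => decide (D.fill b ≠ Fill.plus))

/-- The Grassmannian permutation `v = v_λ`: product of labels of all boxes. -/
def permV {n k : ℕ} (D : Diagram n k) : Equiv.Perm ℕ := readProd D (fun _ => true)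

/-- `u_{b^in}^D`: product of the labels of the stone boxes of `b^in` other than `b`. -/
def uIn {n k : ℕ} (D : Diagram n k) (b : ℕ × ℕ) : Equiv.Perm ℕ :=
  readProd D (fun c => decide (inIn b c ∧ c ≠ b ∧ D.fill c ≠ Fill.plus))

/-- `v_{b^in}`: product of the labels of all boxes of `b^in`. -/
def vIn {n k : ℕ} (D : Diagram n k) (b : ℕ × ℕ) : Equiv.Perm ℕ :=
  readProd D (fun c => decide (inIn b c))

/-- `u_b^D`: the label of `b` if `b` contains a stone, the identity if it contains a plus. -/
def uBox {n k : ℕ} (D : Diagram n k) (b : ℕ × ℕ) : Equiv.Perm ℕ :=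
  if D.fill b = Fill.plus then 1 else sbox n k b

/-- The length-drop condition `ℓ(u_{b^in} u_b s_b) < ℓ(u_{b^in} u_b)` at box `b`. -/
def lenDrop {n k : ℕ} (D : Diagram n k) (b : ℕ × ℕ) : Prop :=
  len n (uIn D b * uBox D b * sbox n k b) < len n (uIn D b * uBox D b)

/-- `b` violates the distinguished property: the length drops at `b`, but `b` is
not filled with a black stone. -/
def ViolatesDist {n k : ℕ} (D : Diagram n k) (b : ℕ × ℕ) : Prop :=
  b ∈ D.S.boxes ∧ D.fill b ≠ Fill.black ∧ lenDrop D b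

/-- `D` is a Go-diagram: a box contains a black stone iff the length drops there. -/
def IsGoDiagram {n k : ℕ} (D : Diagram n k) : Prop :=
  ∀ b ∈ D.S.boxes, (D.fill b = Fill.black ↔ lenDrop D b)

/-- Number of boxes of `D` with filling `f`. -/
def countFill {n k : ℕ} (D : Diagram n k) (f : Fill) : ℕ :=
  (D.S.boxes.filter (fun b => D.fill b = f)).card

/-- Length of row `r` of the shape. -/
def rowLen {n k : ℕ} (S : Shape n k) (r : ℕ) : ℕ :=
  ((Finset.range (n - k)).filter (fun c => (r, c) ∈ S.boxes)).card

/-- The (0-indexed) label of the vertical boundary step in row `r`. -/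
def vlab {n k : ℕ} (S : Shape n k) (r : ℕ) : ℕ := r + (n - k) - rowLen S r

/-- The (0-indexed) label of the horizontal boundary step in column `c`. -/
def hlab {n k : ℕ} (S : Shape n k) (c : ℕ) : ℕ :=
  (n - k - 1 - c) + ((Finset.range k).filter (fun r => c < rowLen S r)).card

/-- Labels of the pipes of the pipe dream of `D`: `pipeAux D fuel true b` is the
label of the pipe entering box `b` from the bottom, `pipeAux D fuel false b` the
label of the pipe entering from the right (stones are crossing tiles, pluses are
elbow tiles; pipes enter from the southeast boundary). -/
def pipeAux {n k : ℕ} (D : Diagram n k) : ℕ → Bool → ℕ × ℕ → ℕ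
  | 0, _, _ => 0
  | fuel + 1, true, b =>
      if (b.1 + 1, b.2) ∈ D.S.boxes then
        (if D.fill (b.1 + 1, b.2) = Fill.plus then pipeAux D fuel false (b.1 + 1, b.2)
          else pipeAux D fuel true (b.1 + 1, b.2))
      else hlab D.S b.2
  | fuel + 1, false, b =>
      if (b.1, b.2 + 1) ∈ D.S.boxes then
        (if D.fill (b.1, b.2 + 1) = Fill.plus then pipeAux D fuel true (b.1, b.2 + 1)
          else pipeAux D fuel false (b.1, b.2 + 1))
      else vlab D.S b.1

/-- The label of the pipe entering box `b` from the bottom. -/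
def pipeB {n k : ℕ} (D : Diagram n k) (b : ℕ × ℕ) : ℕ := pipeAux D (n + 1) true b

/-- The label of the pipe entering box `b` from the right. -/
def pipeR {n k : ℕ} (D : Diagram n k) (b : ℕ × ℕ) : ℕ := pipeAux D (n + 1) false b

/-- `b` is a box of `D` containing a stone (black or white). -/
def IsStone {n k : ℕ} (D : Diagram n k) (b : ℕ × ℕ) : Prop :=
  b ∈ D.S.boxes ∧ D.fill b ≠ Fill.plus

/-- The (unordered) pair of pipes passing through box `b`. -/
def pipePair {n k : ℕ} (D : Diagram n k) (b : ℕ × ℕ) : Finset ℕ :=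
  {pipeB D b, pipeR D b}

/-- `b, c` form a crossing/uncrossing pair: the same two pipes cross at `b`
(the pipe entering from the bottom is larger), flow northwest, and next
uncross at `c`. -/
def CrossUncrossPair {n k : ℕ} (D : Diagram n k) (b c : ℕ × ℕ) : Prop :=
  IsStone D b ∧ IsStone D c ∧ b ≠ c ∧
  pipeR D b < pipeB D b ∧ pipeB D c < pipeR D c ∧
  pipePair D b = pipePair D c ∧ inIn c b ∧
  ∀ d : ℕ × ℕ, IsStone D d → pipePair D d = pipePair D b →
    inIn c d → inIn d b → d = b ∨ d = c

/-- Stones of `D` are colored black iff they are uncrossing tiles. -/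
def BlackIffUncross {n k : ℕ} (D : Diagram n k) : Prop :=
  ∀ b ∈ D.S.boxes, (D.fill b = Fill.black ↔ (D.fill b ≠ Fill.plus ∧ pipeB D b < pipeR D b))

/-- Change the filling of box `b` to `f`. -/
def setFill {n k : ℕ} (D : Diagram n k) (b : ℕ × ℕ) (f : Fill) : Diagram n k :=
  ⟨D.S, fun c => if c = b then f else D.fill c⟩

/-- Recolor the stones of `D` so that a stone is black iff it is an uncrossing. -/
def recolor {n k : ℕ} (D : Diagram n k) : Diagram n k :=
  ⟨D.S, fun b => if D.fill b = Fill.plus then Fill.plus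
    else if pipeB D b < pipeR D b then Fill.black else Fill.white⟩

/-- Equality of diagrams: same shape and the same filling on every box of the shape. -/
def DEq {n k : ℕ} (D D' : Diagram n k) : Prop :=
  D.S = D'.S ∧ ∀ b ∈ D.S.boxes, D.fill b = D'.fill b

/-- The diagram obtained by switching the plus at `p` with the stone at `t`, then
recoloring stones black iff they are uncrossings. -/
def flipPlusWith {n k : ℕ} (D : Diagram n k) (p t : ℕ × ℕ) : Diagram n k :=
  recolor (setFill (setFill D p Fill.white) t Fill.plus)

/-- `(p, t)` is a legal corrective-flip pair for `D`: `p` is a plus violating the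
distinguished property, and `t` is either the white stone `w` with which it violates
the distinguished property (i.e. placing a crossing at `p` makes `(w, p)` a
crossing/uncrossing pair), or `w`'s uncrossing partner, if it exists. -/
def IsFlipPair {n k : ℕ} (D : Diagram n k) (p t : ℕ × ℕ) : Prop :=
  p ∈ D.S.boxes ∧ D.fill p = Fill.plus ∧ lenDrop D p ∧
  ∃ w : ℕ × ℕ, CrossUncrossPair (setFill D p Fill.white) w p ∧
    (t = w ∨ CrossUncrossPair D w t)

/-- `D'` is obtained from `D` by performing a corrective flip. -/
def IsCorrectiveFlip {n k : ℕ} (D D' : Diagram n k) : Prop :=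
  ∃ p t : ℕ × ℕ, IsFlipPair D p t ∧ DEq D' (flipPlusWith D p t)

/-- Product of the simple transpositions along a word. -/
def wordProd (w : List ℕ) : Equiv.Perm ℕ := (w.map sw).prod

/-- Bruhat order on `S_n`: `u ≤ v` iff some reduced word for `u` is a subword of
some reduced word for `v`. -/
def BruhatLE (n : ℕ) (u v : Equiv.Perm ℕ) : Prop :=
  ∃ wv : List ℕ, (∀ i ∈ wv, i + 1 < n) ∧ wordProd wv = v ∧ wv.length = len n v ∧
    ∃ wu : List ℕ, wu.Sublist wv ∧ wordProd wu = u ∧ wu.length = len n u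

/-- Componentwise order on finite subsets of `ℕ`. -/
def FinsetLE (S T : Finset ℕ) : Prop :=
  List.Forall₂ (· ≤ ·) (S.sort (· ≤ ·)) (T.sort (· ≤ ·))

/-- Strict componentwise order on finite subsets of `ℕ`. -/
def FinsetLT (S T : Finset ℕ) : Prop := FinsetLE S T ∧ S ≠ T

/-- The (0-indexed) top set `{n-k, …, n-1}` (the set `{n-k+1, …, n}` of the paper). -/
def topSet (n k : ℕ) : Finset ℕ := (Finset.range n).filter (fun i => n - k ≤ i)

/-- The set `I_b = u_{b^in} u_b (v_{b^in})⁻¹ v {n, n-1, …, n-k+1}`. -/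
def Iset {n k : ℕ} (D : Diagram n k) (b : ℕ × ℕ) : Finset ℕ :=
  (topSet n k).image (fun x => (uIn D b * uBox D b * (vIn D b)⁻¹ * permV D) x)

/-- The set `J_b = u_{b^in} (v_{b^in})⁻¹ v {n, n-1, …, n-k+1}`. -/
def Jset {n k : ℕ} (D : Diagram n k) (b : ℕ × ℕ) : Finset ℕ :=
  (topSet n k).image (fun x => (uIn D b * (vIn D b)⁻¹ * permV D) x)

/-- `I_λ`: the set of labels of the vertical boundary steps of the shape. -/
def Ilam {n k : ℕ} (S : Shape n k) : Finset ℕ := (Finset.range k).image (fun r => vlab S r)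

/-- The Plücker coordinate of a `k × n` matrix at a `k`-subset `I ⊆ {0,…,n-1}`. -/
noncomputable def plucker {n k : ℕ} (A : Matrix (Fin k) (Fin n) ℝ) (I : Finset ℕ) : ℝ :=
  Matrix.det (Matrix.of fun i j : Fin k =>
    if h : (I.sort (· ≤ ·)).getD (j : ℕ) 0 < n then A i ⟨(I.sort (· ≤ ·)).getD (j : ℕ) 0, h⟩
    else 0)

/-- Full-rank `k × n` real matrices: representatives of points of `Gr(k,n)`. -/
def GrRep (k n : ℕ) : Type := {A : Matrix (Fin k) (Fin n) ℝ // A.rank = k}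

instance (k n : ℕ) : TopologicalSpace (GrRep k n) := by unfold GrRep; infer_instance

/-- Row equivalence of full-rank matrices. -/
def grSetoid (k n : ℕ) : Setoid (GrRep k n) where
  r A B := ∃ g : Matrix (Fin k) (Fin k) ℝ, IsUnit g.det ∧ B.1 = g * A.1
  iseqv := by
    refine ⟨fun A => ⟨1, ?_, ?_⟩, ?_, ?_⟩
    · simp
    · simp
    · rintro A B ⟨g, hg, hB⟩
      refine ⟨g⁻¹, Matrix.isUnit_nonsing_inv_det g hg, ?_⟩
      rw [hB, ← Matrix.mul_assoc, Matrix.nonsing_inv_mul g hg, Matrix.one_mul]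
    · rintro A B C ⟨g, hg, hB⟩ ⟨h, hh, hC⟩
      exact ⟨h * g, by rw [Matrix.det_mul]; exact hh.mul hg,
        by rw [hC, hB, Matrix.mul_assoc]⟩

/-- The Grassmannian `Gr(k,n)`, as the quotient of full-rank `k × n` matrices by
row equivalence, with the quotient topology. -/
def Gr (k n : ℕ) : Type := Quotient (grSetoid k n)

instance (k n : ℕ) : TopologicalSpace (Gr k n) := by
  unfold Gr; exact instTopologicalSpaceQuotient

/-- Matrix representatives of the Deodhar component indexed by a Go-diagram `D`:
`Δ_{I_b} = 0` for white-stone boxes, `Δ_{I_b} ≠ 0` for plus boxes, `Δ_{I_λ} ≠ 0`,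
and `Δ_S = 0` whenever `S ≱ I_λ`. -/
def deodharRep {n k : ℕ} (D : Diagram n k) : Set (Matrix (Fin k) (Fin n) ℝ) :=
  {A | (∀ b ∈ D.S.boxes, D.fill b = Fill.white → plucker A (Iset D b) = 0) ∧
      (∀ b ∈ D.S.boxes, D.fill b = Fill.plus → plucker A (Iset D b) ≠ 0) ∧
      plucker A (Ilam D.S) ≠ 0 ∧
      (∀ S : Finset ℕ, S ⊆ Finset.range n → S.card = k →
        ¬ FinsetLE (Ilam D.S) S → plucker A S = 0)}

/-- The Deodhar component in `Gr(k,n)` indexed by a Go-diagram `D`. -/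
def deodhar {n k : ℕ} (D : Diagram n k) : Set (Gr k n) :=
  {x | ∃ A : GrRep k n, Quotient.mk (grSetoid k n) A = x ∧ A.1 ∈ deodharRep D}

/-- The dimension of the Deodhar component indexed by `D` (by Deodhar's theorem,
the component is homeomorphic to `ℝ^{#black} × (ℝ \ {0})^{#plus}`). -/
def dimD {n k : ℕ} (D : Diagram n k) : ℕ :=
  countFill D Fill.black + countFill D Fill.plus

/-- The positroid cell of shape `S` and permutation `u`: the union of the Deodhar
components indexed by Go-diagrams of shape `S` with pipe-dream permutation `u`. -/
def positroid {n k : ℕ} (S : Shape n k) (u : Equiv.Perm ℕ) : Set (Gr k n) :=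
  {x | ∃ D : Diagram n k, D.S = S ∧ IsGoDiagram D ∧ permU D = u ∧ x ∈ deodhar D}

/-- A Le-diagram: no black stones, and no white stone with a plus above it in its
column and a plus to its left in its row. -/
def IsLeDiagram {n k : ℕ} (D : Diagram n k) : Prop :=
  (∀ b ∈ D.S.boxes, D.fill b ≠ Fill.black) ∧
  ∀ b ∈ D.S.boxes, D.fill b = Fill.white →
    ¬((∃ r : ℕ, r < b.1 ∧ D.fill (r, b.2) = Fill.plus) ∧
      (∃ c : ℕ, c < b.2 ∧ D.fill (b.1, c) = Fill.plus))

/-- A Le-move: on a rectangle with pluses in the top-left, top-right and bottom-left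
corners, a white stone in the bottom-right corner, and white stones elsewhere,
exchange the top-left plus with the bottom-right white stone. -/
def IsLeMove {n k : ℕ} (D D' : Diagram n k) : Prop :=
  D'.S = D.S ∧
  ∃ r1 r2 c1 c2 : ℕ, r1 < r2 ∧ c1 < c2 ∧ (r2, c2) ∈ D.S.boxes ∧
    D.fill (r1, c1) = Fill.plus ∧ D.fill (r1, c2) = Fill.plus ∧
    D.fill (r2, c1) = Fill.plus ∧ D.fill (r2, c2) = Fill.white ∧
    (∀ r c : ℕ, r1 ≤ r → r ≤ r2 → c1 ≤ c → c ≤ c2 →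
      ¬((r = r1 ∨ r = r2) ∧ (c = c1 ∨ c = c2)) → D.fill (r, c) = Fill.white) ∧
    D'.fill (r1, c1) = Fill.white ∧ D'.fill (r2, c2) = Fill.plus ∧
    (∀ b : ℕ × ℕ, b ≠ (r1, c1) → b ≠ (r2, c2) → D'.fill b = D.fill b)

/-- The first black stone or plus strictly to the right of `b` in its row. -/
def firstRight {n k : ℕ} (D : Diagram n k) (b : ℕ × ℕ) : Option (ℕ × ℕ) :=
  ((List.range (n - k)).map fun t => (b.1, b.2 + 1 + t)).find?
    (fun x => decide (x ∈ D.S.boxes ∧ D.fill x ≠ Fill.white))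

/-- The first black stone or plus strictly below `b` in its column. -/
def firstDown {n k : ℕ} (D : Diagram n k) (b : ℕ × ℕ) : Option (ℕ × ℕ) :=
  ((List.range k).map fun t => (b.1 + 1 + t, b.2)).find?
    (fun x => decide (x ∈ D.S.boxes ∧ D.fill x ≠ Fill.white))

/-- `x` is (relative to the oracle `pf`) the partner of some black stone of `b^in`
other than `b`. -/
noncomputable def partneredWhite {n k : ℕ} (D : Diagram n k) (pf : ℕ × ℕ → Option (ℕ × ℕ))
    (b x : ℕ × ℕ) : Bool :=
  D.S.boxes.toList.any fun d =>
    decide (inIn b d ∧ d ≠ b ∧ D.fill d = Fill.black ∧ pf d = some x)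

/-- Step 5 of the partner algorithm: the path from `b` travelling right
(`dir = true`) or down (`dir = false`), given an oracle `pf` of previously
assigned partners; turns at pluses, jumps at black stones to their partners,
and turns at white stones partnered with black stones of `b^in`. -/
noncomputable def pathAux {n k : ℕ} (D : Diagram n k) (pf : ℕ × ℕ → Option (ℕ × ℕ)) (b : ℕ × ℕ) :
    ℕ → Bool → ℕ × ℕ → List (ℕ × ℕ)
  | 0, _, _ => []
  | fuel + 1, dir, x =>
      let x' : ℕ × ℕ := if dir then (x.1, x.2 + 1) else (x.1 + 1, x.2)
      if x' ∈ D.S.boxes then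
        match D.fill x' with
        | Fill.plus => x' :: pathAux D pf b fuel (!dir) x'
        | Fill.black =>
            match pf x' with
            | some q => x' :: q :: pathAux D pf b fuel (!dir) q
            | none => [x']
        | Fill.white =>
            if partneredWhite D pf b x' then x' :: pathAux D pf b fuel (!dir) x'
            else x' :: pathAux D pf b fuel dir x'
      else []

/-- One step of the partner algorithm at box `b`, given an oracle `pf` of
previously assigned partners. Returns (partner of `b`, path `P_b`, path `Q_b`). -/
noncomputable def partnerCore {n k : ℕ} (D : Diagram n k) (pf : ℕ × ℕ → Option (ℕ × ℕ)) (b : ℕ × ℕ) :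
    Option (ℕ × ℕ) × List (ℕ × ℕ) × List (ℕ × ℕ) :=
  match firstRight D b, firstDown D b with
  | some c, some d =>
      let e : ℕ × ℕ := (d.1, c.2)
      if e ∈ D.S.boxes ∧
          (¬ ∃ i ∈ Finset.range d.1, b.1 < i ∧ (i, c.2) ∈ D.S.boxes ∧
            D.fill (i, c.2) ≠ Fill.white) ∧
          (¬ ∃ j ∈ Finset.range c.2, b.2 < j ∧ (d.1, j) ∈ D.S.boxes ∧
            D.fill (d.1, j) ≠ Fill.white) then
        if D.fill e = Fill.white then
          (some e,
            b :: (((List.range (c.2 - b.2)).map fun t => (b.1, b.2 + 1 + t)) ++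
              ((List.range (d.1 - b.1)).map fun t => (b.1 + 1 + t, c.2))),
            b :: (((List.range (d.1 - b.1)).map fun t => (b.1 + 1 + t, b.2)) ++
              ((List.range (c.2 - b.2)).map fun t => (d.1, b.2 + 1 + t))))
        else
          let P := b :: pathAux D pf b (n + 1) true b
          let Q := b :: pathAux D pf b (n + 1) false b
          let common := P.filter (fun m => decide (m ∈ Q))
          match common.find? (fun m => common.all fun m' => decide (inIn m m')) with
          | some m => (if D.fill m = Fill.white then some m else none, P, Q)
          | none => (none, P, Q)
      else (none, [], [])
  | _, _ => (none, [], [])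

/-- Iterated partner assignment (the recursion bottoms out along the partial
order `≼`, whose chains have length at most `n`). -/
noncomputable def partnerAux {n k : ℕ} (D : Diagram n k) : ℕ → ℕ × ℕ → Option (ℕ × ℕ)
  | 0, _ => none
  | m + 1, b => (partnerCore D (partnerAux D m) b).1

/-- The partner of box `b` in `D` (if any), per the recursive partner algorithm. -/
noncomputable def partner {n k : ℕ} (D : Diagram n k) (b : ℕ × ℕ) : Option (ℕ × ℕ) :=
  partnerAux D (n + 2) b

/-- The path `P_b` of the partner algorithm. -/
noncomputable def pathP {n k : ℕ} (D : Diagram n k) (b : ℕ × ℕ) : List (ℕ × ℕ) :=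
  (partnerCore D (partnerAux D (n + 1)) b).2.1

/-- The path `Q_b` of the partner algorithm. -/
noncomputable def pathQ {n k : ℕ} (D : Diagram n k) (b : ℕ × ℕ) : List (ℕ × ℕ) :=
  (partnerCore D (partnerAux D (n + 1)) b).2.2

/-- `f(D,b)`: replace with pluses all black stones in boxes `c ≺ b` and all white
stones that are partners of such boxes. -/
noncomputable def fDb {n k : ℕ} (D : Diagram n k) (b : ℕ × ℕ) : Diagram n k :=
  ⟨D.S, fun x =>
    if (D.fill x = Fill.black ∧ inIn b x ∧ x ≠ b) ∨
        (∃ c ∈ D.S.boxes, inIn b c ∧ c ≠ b ∧ D.fill c = Fill.black ∧ partner D c = some x)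
    then Fill.plus else D.fill x⟩

/-- Replace all black stones of `D`, and all of their partners, with pluses. -/
noncomputable def reduceGo {n k : ℕ} (D : Diagram n k) : Diagram n k :=
  ⟨D.S, fun x =>
    if D.fill x = Fill.black ∨
        (∃ c ∈ D.S.boxes, D.fill c = Fill.black ∧ partner D c = some x)
    then Fill.plus else D.fill x⟩

/-- Product, in a reading order, of the labels of the stone boxes of `b^in`. -/
def stonesProd {n k : ℕ} (D : Diagram n k) (b : ℕ × ℕ) : Equiv.Perm ℕ :=
  readProd D (fun c => decide (inIn b c ∧ D.fill c ≠ Fill.plus))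

/-- Property (P1) at `b`: the product of the labels of the stone boxes of `b^in`
is the same in `f(D,b)` as in `D`. -/
def P1 {n k : ℕ} (D : Diagram n k) (b : ℕ × ℕ) : Prop :=
  stonesProd (fDb D b) b = stonesProd D b

/-- Property (P2) at `b`: `b` has partner `p` iff `p` and `b` form a
crossing/uncrossing pair in the pipe dream of `f(D,b)`. -/
def P2 {n k : ℕ} (D : Diagram n k) (b : ℕ × ℕ) : Prop :=
  ∀ p : ℕ × ℕ, (partner D b = some p ↔ CrossUncrossPair (fDb D b) p b)

/-- `D` is a (nonempty) full `rows × cols` rectangle. -/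
def IsRectangle {n k : ℕ} (D : Diagram n k) (rows cols : ℕ) : Prop :=
  0 < rows ∧ 0 < cols ∧ D.S.boxes = Finset.range rows ×ˢ Finset.range cols

/-- A minimal violation: a rectangular diagram in which the only box violating the
distinguished property is the top-left corner, and the pair of pipes that should
uncross there initially cross in the bottom-right corner. -/
def IsMinimalViolation {n k : ℕ} (D : Diagram n k) (rows cols : ℕ) : Prop :=
  IsRectangle D rows cols ∧
  ViolatesDist D (0, 0) ∧
  (∀ b ∈ D.S.boxes, ViolatesDist D b → b = (0, 0)) ∧
  pipePair D (0, 0) = pipePair D (rows - 1, cols - 1) ∧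
  D.fill (rows - 1, cols - 1) ≠ Fill.plus ∧
  pipeR D (rows - 1, cols - 1) < pipeB D (rows - 1, cols - 1)


/-! ### Reduced words and the strong exchange property -/

theorem sw_apply (i a : ℕ) :
    sw i a = if a = i then i + 1 else if a = i + 1 then i else a :=
  Equiv.swap_apply_def i (i + 1) a

theorem sw_mul_self (i : ℕ) : sw i * sw i = 1 := Equiv.swap_mul_self i (i + 1)

theorem wordProd_append (w w' : List ℕ) : wordProd (w ++ w') = wordProd w * wordProd w' := by
  simp [wordProd]

theorem wordProd_singleton (i : ℕ) : wordProd [i] = sw i := by simp [wordProd]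

/-- Multiplying by `s_i` on the right at an ascent increases the length by one. -/
theorem len_mul_sw_of_lt {n i : ℕ} (hi : i + 1 < n) (v : Equiv.Perm ℕ) (h : v i < v (i + 1)) :
    len n (v * sw i) = len n v + 1 := by
  have key : (Finset.range n ×ˢ Finset.range n).filter
        (fun p => p.1 < p.2 ∧ (v * sw i) p.2 < (v * sw i) p.1) =
      insert (i, i + 1) (((Finset.range n ×ˢ Finset.range n).filter
        (fun p => p.1 < p.2 ∧ v p.2 < v p.1)).map
          ((sw i).prodCongr (sw i)).toEmbedding) := by
    ext ⟨a, b⟩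
    rw [Finset.mem_insert, Finset.mem_map_equiv, Finset.mem_filter,
      Finset.mem_filter]
    simp only [Finset.mem_product, Finset.mem_range, Equiv.Perm.mul_apply,
      Prod.mk.injEq, Equiv.prodCongr_symm, Equiv.prodCongr_apply, Prod.map]
    have hs : (sw i).symm = sw i := Equiv.symm_swap _ _
    simp only [hs, sw_apply]
    by_cases ha : a = i <;> by_cases ha' : a = i + 1 <;> by_cases hb : b = i <;>
      by_cases hb' : b = i + 1 <;> simp only [ha, ha', hb, hb', ↓reduceIte] <;>
      simp <;> omega
  unfold len
  rw [key, Finset.card_insert_of_notMem, Finset.card_map]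
  rw [Finset.mem_map_equiv]
  have hs : (sw i).symm = sw i := Equiv.symm_swap _ _
  simp [hs, sw_apply]

/-- Multiplying by `s_i` on the right at a descent decreases the length by one. -/
theorem len_mul_sw_of_gt {n i : ℕ} (hi : i + 1 < n) (v : Equiv.Perm ℕ) (h : v (i + 1) < v i) :
    len n (v * sw i) + 1 = len n v := by
  have := len_mul_sw_of_lt hi (v * sw i) (by simpa [sw_apply] using h)
  rw [mul_assoc, sw_mul_self, mul_one] at this
  exact this.symm

/-- Strong exchange: multiplying by a transposition that removes an inversion amounts to
deleting one letter of a word. -/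
theorem exists_sublist_mul_swap (w : List ℕ) : ∀ a b : ℕ, a < b → wordProd w b < wordProd w a →
    ∃ w', w'.Sublist w ∧ w'.length + 1 = w.length ∧
      wordProd w' = wordProd w * Equiv.swap a b := by
  induction w using List.reverseRecOn with
  | nil => intro a b hab h; simp [wordProd] at h; omega
  | append_singleton w i ih =>
    intro a b hab h
    rw [wordProd_append, wordProd_singleton] at h ⊢
    by_cases hi : a = i ∧ b = i + 1
    · obtain ⟨rfl, rfl⟩ := hi
      refine ⟨w, List.sublist_append_left _ _, by simp, ?_⟩
      change _ = wordProd w * sw a * sw a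
      rw [mul_assoc, sw_mul_self, mul_one]
    · have hlt : sw i a < sw i b := by
        rw [sw_apply, sw_apply]; split_ifs <;> omega
      obtain ⟨w', hs, hl, hp⟩ := ih _ _ hlt h
      refine ⟨w' ++ [i], hs.append_right _, by simp [hl], ?_⟩
      rw [wordProd_append, wordProd_singleton, hp, mul_assoc, mul_assoc,
        Equiv.mul_swap_eq_swap_mul (sw i) a b]

/-- Every word contains a reduced word for the same permutation. -/
theorem exists_reduced_sublist {n : ℕ} (w : List ℕ) (hw : ∀ i ∈ w, i + 1 < n) :
    ∃ w', w'.Sublist w ∧ wordProd w' = wordProd w ∧ w'.length = len n (wordProd w) := by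
  induction w using List.reverseRecOn with
  | nil =>
    refine ⟨[], List.Sublist.refl _, rfl, ?_⟩
    symm
    simp only [len, List.length_nil, Finset.card_eq_zero, Finset.filter_eq_empty_iff]
    rintro ⟨a, b⟩ - ⟨h1, h2⟩
    simp [wordProd] at h1 h2
    omega
  | append_singleton w i ih =>
    obtain ⟨w', hs, hp, hl⟩ := ih fun j hj => hw j (by simp [hj])
    have hi : i + 1 < n := hw i (by simp)
    rw [wordProd_append, wordProd_singleton]
    rcases lt_or_ge (wordProd w i) (wordProd w (i + 1)) with h | h
    · refine ⟨w' ++ [i], hs.append_right _, ?_, ?_⟩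
      · rw [wordProd_append, wordProd_singleton, hp]
      · simp [hl, len_mul_sw_of_lt hi _ h]
    · have hlt : wordProd w (i + 1) < wordProd w i :=
        lt_of_le_of_ne h fun e => by simpa using (wordProd w).injective e
      obtain ⟨w'', hs', hl', hp'⟩ :=
        exists_sublist_mul_swap w' i (i + 1) (Nat.lt_succ_self i) (by rwa [hp])
      refine ⟨w'', hs'.trans (hs.trans (List.sublist_append_left _ _)), ?_, ?_⟩
      · rw [hp', hp]; rfl
      · have := len_mul_sw_of_gt hi _ hlt
        omega

theorem bruhatLE_refl {n : ℕ} (w : List ℕ) (hw : ∀ i ∈ w, i + 1 < n) :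
    BruhatLE n (wordProd w) (wordProd w) := by
  obtain ⟨w', hs, hp, hl⟩ := exists_reduced_sublist w hw
  exact ⟨w', fun i hi => hw i (hs.subset hi), hp, hl, w', List.Sublist.refl _, hp, hl⟩

/-- Removing an inversion by exchanging two values goes down in Bruhat order. -/
theorem bruhatLE_swap_mul {n : ℕ} (w : List ℕ) (hw : ∀ i ∈ w, i + 1 < n) {α β : ℕ}
    (hαβ : α < β) (hinv : (wordProd w)⁻¹ β < (wordProd w)⁻¹ α) :
    BruhatLE n (Equiv.swap α β * wordProd w) (wordProd w) := by
  obtain ⟨w', hs, hp, hl⟩ := exists_reduced_sublist w hw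
  obtain ⟨w₁, hs₁, -, hp₁⟩ := exists_sublist_mul_swap w' _ _ hinv (by simpa [hp] using hαβ)
  have hp₂ : wordProd w₁ = Equiv.swap α β * wordProd w := by
    rw [hp₁, hp, Equiv.mul_swap_eq_swap_mul]
    simp [Equiv.swap_comm]
  obtain ⟨w₂, hs₂, hp₃, hl₂⟩ :=
    exists_reduced_sublist (n := n) w₁ fun i hi => hw i (hs.subset (hs₁.subset hi))
  exact ⟨w', fun i hi => hw i (hs.subset hi), hp, hl, w₂, hs₂.trans hs₁,
    hp₃.trans hp₂, hp₂ ▸ hl₂⟩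

/-! ### Readings of southeast-closed sets of boxes -/

/-- A list of distinct boxes in which every box is preceded by all boxes strictly
southeast of it. -/
inductive IsReading {n k : ℕ} (S : Shape n k) : List (ℕ × ℕ) → Prop
  | nil : IsReading S []
  | snoc (P : List (ℕ × ℕ)) (x : ℕ × ℕ) : IsReading S P → x ∈ S.boxes → x ∉ P →
      (∀ y ∈ S.boxes, inIn x y → y ≠ x → y ∈ P) → IsReading S (P ++ [x])

theorem IsReading.mem_of_inIn {n k : ℕ} {S : Shape n k} {P : List (ℕ × ℕ)} (h : IsReading S P)
    {y z : ℕ × ℕ} (hy : y ∈ P) (hz : z ∈ S.boxes) (hyz : inIn y z) : z ∈ P := by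
  induction h with
  | nil => simp at hy
  | snoc P x _ _ _ hprev ih =>
    rw [List.mem_append, List.mem_singleton] at hy ⊢
    rcases hy with hy | rfl
    · exact Or.inl (ih hy)
    · by_cases hzy : z = y
      · exact Or.inr hzy
      · exact Or.inl (hprev z hz hyz hzy)

theorem IsReading.mem_boxes {n k : ℕ} {S : Shape n k} {P : List (ℕ × ℕ)} (h : IsReading S P)
    {y : ℕ × ℕ} (hy : y ∈ P) : y ∈ S.boxes := by
  induction h with
  | nil => simp at hy
  | snoc P x _ hx _ _ ih =>
    rw [List.mem_append, List.mem_singleton] at hy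
    rcases hy with hy | rfl
    · exact ih hy
    · exact hx

theorem isReading_of_pairwise {n k : ℕ} {S : Shape n k} (L : List (ℕ × ℕ))
    (hpw : L.Pairwise fun x y => ¬ inIn x y) (hS : ∀ x ∈ L, x ∈ S.boxes)
    (hcl : ∀ x ∈ L, ∀ y ∈ S.boxes, inIn x y → y ∈ L) : IsReading S L := by
  induction L using List.reverseRecOn with
  | nil => exact .nil
  | append_singleton P x ih =>
    rw [List.pairwise_append] at hpw
    obtain ⟨h1, -, h2⟩ := hpw
    refine .snoc P x (ih h1 (fun y hy => hS y (by simp [hy])) ?_) (hS x (by simp)) ?_ ?_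
    · intro z hz y hy hzy
      have := hcl z (by simp [hz]) y hy hzy
      rw [List.mem_append, List.mem_singleton] at this
      rcases this with h | rfl
      · exact h
      · exact absurd hzy (h2 z hz y (by simp))
    · intro hx
      exact h2 x hx x (by simp) ⟨le_rfl, le_rfl⟩
    · intro y hy hxy hne
      have := hcl x (by simp) y hy hxy
      rw [List.mem_append, List.mem_singleton] at this
      exact this.resolve_right hne

theorem mem_readingList {n k : ℕ} (S : Shape n k) (x : ℕ × ℕ) :
    x ∈ readingList S ↔ x ∈ S.boxes := by
  obtain ⟨r, c⟩ := x
  simp only [readingList, List.mem_filter, List.mem_flatMap, List.mem_reverse, List.mem_range,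
    List.mem_map, Prod.mk.injEq, decide_eq_true_eq]
  constructor
  · exact fun h => h.2
  · exact fun h => ⟨⟨r, S.row_lt _ h, c, S.col_lt _ h, rfl, rfl⟩, h⟩

theorem readingList_pairwise {n k : ℕ} (S : Shape n k) :
    (readingList S).Pairwise fun x y => ¬ inIn x y := by
  refine List.Pairwise.filter _ ?_
  rw [List.pairwise_flatMap]
  refine ⟨fun r _ => ?_, ?_⟩
  · rw [List.pairwise_map, List.pairwise_reverse]
    refine List.pairwise_lt_range.imp ?_
    intro a b h h'
    have := h'.2
    simp only at this
    omega
  · rw [List.pairwise_reverse]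
    refine List.pairwise_lt_range.imp ?_
    intro a b h x hx y hy h'
    simp only [List.mem_map] at hx hy
    obtain ⟨_, _, rfl⟩ := hx
    obtain ⟨_, _, rfl⟩ := hy
    have := h'.1
    simp only at this
    omega

theorem isReading_filter {n k : ℕ} (S : Shape n k) (q : ℕ × ℕ → Bool)
    (hq : ∀ x ∈ S.boxes, q x = true → ∀ y ∈ S.boxes, inIn x y → q y = true) :
    IsReading S ((readingList S).filter q) := by
  refine isReading_of_pairwise _ ((readingList_pairwise S).filter _) ?_ ?_
  · intro x hx
    exact (mem_readingList S x).1 (List.mem_filter.1 hx).1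
  · intro x hx y hy hxy
    rw [List.mem_filter, mem_readingList] at hx ⊢
    exact ⟨hy, hq x hx.1 hx.2 y hy hxy⟩

/-- The labels of the stones of a list of boxes. -/
def stoneWord {n k : ℕ} (D : Diagram n k) (P : List (ℕ × ℕ)) : List ℕ :=
  (P.filter fun c => decide (D.fill c ≠ Fill.plus)).map (lab n k)

theorem wordProd_stoneWord_snoc_plus {n k : ℕ} (D : Diagram n k) (P : List (ℕ × ℕ)) {x : ℕ × ℕ}
    (hx : D.fill x = Fill.plus) :
    wordProd (stoneWord D (P ++ [x])) = wordProd (stoneWord D P) := by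
  simp [stoneWord, hx]

theorem wordProd_stoneWord_snoc_stone {n k : ℕ} (D : Diagram n k) (P : List (ℕ × ℕ))
    {x : ℕ × ℕ} (hx : D.fill x ≠ Fill.plus) :
    wordProd (stoneWord D (P ++ [x])) = wordProd (stoneWord D P) * sw (lab n k x) := by
  simp [stoneWord, hx, wordProd]

theorem lab_succ_lt {n k : ℕ} (S : Shape n k) {x : ℕ × ℕ} (hx : x ∈ S.boxes) :
    lab n k x + 1 < n := by
  have h1 := S.row_lt x hx
  have h2 := S.col_lt x hx
  unfold lab
  omega

theorem stoneWord_lt {n k : ℕ} (D : Diagram n k) {P : List (ℕ × ℕ)} (h : IsReading D.S P) :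
    ∀ i ∈ stoneWord D P, i + 1 < n := by
  intro i hi
  simp only [stoneWord, List.mem_map, List.mem_filter] at hi
  obtain ⟨x, ⟨hx, -⟩, rfl⟩ := hi
  exact lab_succ_lt D.S (h.mem_boxes hx)

/-- The boxes of `b^in` other than `b`, in the canonical reading order. -/
def inList {n k : ℕ} (S : Shape n k) (b : ℕ × ℕ) : List (ℕ × ℕ) :=
  (readingList S).filter fun c => decide (inIn b c ∧ c ≠ b)

theorem uIn_eq_wordProd {n k : ℕ} (D : Diagram n k) (b : ℕ × ℕ) :
    uIn D b = wordProd (stoneWord D (inList D.S b)) := by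
  unfold uIn readProd wordProd stoneWord inList
  rw [List.filter_filter, List.map_map]
  congr 2
  refine List.filter_congr fun c _ => ?_
  simp only [ne_eq, Bool.decide_and]
  grind

theorem isReading_inList {n k : ℕ} (S : Shape n k) (b : ℕ × ℕ) : IsReading S (inList S b) := by
  refine isReading_filter S _ ?_
  rintro ⟨r, c⟩ - hx ⟨r', c'⟩ - hxy
  obtain ⟨rb, cb⟩ := b
  simp only [inIn, decide_eq_true_eq, ne_eq, Prod.mk.injEq] at *
  omega

/-! ### Boundary labels and pipes -/

theorem mem_iff_lt_card_of_downClosed (A : Finset ℕ) (hA : ∀ a ∈ A, ∀ b ≤ a, b ∈ A) (c : ℕ) :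
    c ∈ A ↔ c < A.card := by
  constructor
  · intro hc
    have : Finset.range (c + 1) ⊆ A := fun b hb => hA c hc b (by simp at hb; omega)
    simpa using Finset.card_le_card this
  · intro hc
    by_contra hn
    have : A ⊆ Finset.range c := by
      intro b hb
      rw [Finset.mem_range]
      by_contra hbc
      exact hn (hA b hb c (by omega))
    have := Finset.card_le_card this
    simp at this
    omega

theorem lt_rowLen_iff {n k : ℕ} (S : Shape n k) (r c : ℕ) :
    c < rowLen S r ↔ (r, c) ∈ S.boxes := by
  unfold rowLen
  rw [← mem_iff_lt_card_of_downClosed]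
  · simp only [Finset.mem_filter, Finset.mem_range, and_iff_right_iff_imp]
    exact fun h => S.col_lt _ h
  · intro a ha b hb
    simp only [Finset.mem_filter, Finset.mem_range] at ha ⊢
    exact ⟨by omega, S.nw_closed _ ha.2 _ _ le_rfl hb⟩

theorem vlab_eq_lab {n k : ℕ} (S : Shape n k) {b : ℕ × ℕ} (hb : b ∈ S.boxes)
    (hr : (b.1, b.2 + 1) ∉ S.boxes) : vlab S b.1 = lab n k b := by
  rw [← lt_rowLen_iff] at hr
  have h1 : b.2 < rowLen S b.1 := (lt_rowLen_iff S _ _).2 hb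
  have h2 := S.col_lt b hb
  unfold vlab lab
  omega

theorem hlab_eq_lab_succ {n k : ℕ} (S : Shape n k) {b : ℕ × ℕ} (hb : b ∈ S.boxes)
    (hd : (b.1 + 1, b.2) ∉ S.boxes) : hlab S b.2 = lab n k b + 1 := by
  have key (r : ℕ) : r < ((Finset.range k).filter (fun r => b.2 < rowLen S r)).card ↔
      (r, b.2) ∈ S.boxes := by
    simp only [lt_rowLen_iff]
    rw [← mem_iff_lt_card_of_downClosed]
    · simp only [Finset.mem_filter, Finset.mem_range, and_iff_right_iff_imp]
      exact fun h => S.row_lt _ h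
    · intro a ha b hb
      simp only [Finset.mem_filter, Finset.mem_range] at ha ⊢
      exact ⟨by omega, S.nw_closed _ ha.2 _ _ hb le_rfl⟩
  rw [← key] at hd
  have h1 := (key b.1).2 hb
  have h2 := S.col_lt b hb
  unfold hlab lab
  omega

/-- After reading a southeast-closed set of boxes, the positions on its northwest frontier
carry the labels of the pipes crossing the frontier. -/
theorem IsReading.frontier {n k : ℕ} {D : Diagram n k} {P : List (ℕ × ℕ)}
    (h : IsReading D.S P) : ∀ b ∈ D.S.boxes, b ∉ P → ∀ f, k + (n - k) ≤ f + b.1 + b.2 →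
      (((b.1, b.2 + 1) ∈ D.S.boxes → (b.1, b.2 + 1) ∈ P) →
        wordProd (stoneWord D P) (lab n k b) = pipeAux D f false b) ∧
      (((b.1 + 1, b.2) ∈ D.S.boxes → (b.1 + 1, b.2) ∈ P) →
        wordProd (stoneWord D P) (lab n k b + 1) = pipeAux D f true b) := by
  induction h with
  | nil =>
    intro b hb _ f hf
    have h1 := D.S.row_lt b hb
    obtain ⟨f, rfl⟩ : ∃ g, f = g + 1 := ⟨f - 1, by have := D.S.col_lt b hb; omega⟩
    constructor
    · intro hr
      have hr : (b.1, b.2 + 1) ∉ D.S.boxes := by simpa using hr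
      simp [pipeAux, hr, stoneWord, wordProd, vlab_eq_lab D.S hb hr]
    · intro hd
      have hd : (b.1 + 1, b.2) ∉ D.S.boxes := by simpa using hd
      simp [pipeAux, hd, stoneWord, wordProd, hlab_eq_lab_succ D.S hb hd]
  | snoc P x hP hx hxP hprev ih =>
    intro b hb hbP f hf
    have hb1 := D.S.row_lt b hb
    have hb2 := D.S.col_lt b hb
    have hx1 := D.S.row_lt x hx
    have hx2 := D.S.col_lt x hx
    rw [List.mem_append, List.mem_singleton, not_or] at hbP
    obtain ⟨hbP, hbx⟩ := hbP
    obtain ⟨ihr, ihd⟩ := ih b hb hbP f hf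
    have hxr : (x.1, x.2 + 1) ∈ D.S.boxes → (x.1, x.2 + 1) ∈ P := fun h =>
      hprev _ h ⟨le_rfl, Nat.le_succ _⟩ (by simp [Prod.ext_iff])
    have hxd : (x.1 + 1, x.2) ∈ D.S.boxes → (x.1 + 1, x.2) ∈ P := fun h =>
      hprev _ h ⟨Nat.le_succ _, le_rfl⟩ (by simp [Prod.ext_iff])
    have hbx' : ¬ (b.1 = x.1 ∧ b.2 = x.2) := fun h => hbx (Prod.ext h.1 h.2)
    -- boxes of `P` cannot lie northwest of `b` or `x`
    have hnot (y z : ℕ × ℕ) (hy : y ∈ P) (hz : z ∈ D.S.boxes) (hzP : z ∉ P) :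
        ¬ inIn y z := fun hyz => hzP (hP.mem_of_inIn hy hz hyz)
    have e1 (c : ℕ × ℕ) (hcP : c ∈ D.S.boxes → c ∈ P) (hcb : b.1 ≤ c.1 ∧ b.2 ≤ c.2) :
        ¬ (c.1 ≤ x.1 ∧ c.2 ≤ x.2) := fun hcx =>
      hnot c x (hcP (D.S.nw_closed x hx c.1 c.2 hcx.1 hcx.2)) hx hxP hcx
    have e2 : ¬ (x.1 ≤ b.1 ∧ x.2 + 1 ≤ b.2) := fun hxb =>
      hnot _ b (hxr (D.S.nw_closed b hb _ _ hxb.1 hxb.2)) hb hbP hxb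
    have e3 : ¬ (x.1 + 1 ≤ b.1 ∧ x.2 ≤ b.2) := fun hxb =>
      hnot _ b (hxd (D.S.nw_closed b hb _ _ hxb.1 hxb.2)) hb hbP hxb
    constructor
    · intro hr
      by_cases hbr : (b.1, b.2 + 1) = x
      · obtain ⟨f, rfl⟩ : ∃ g, f = g + 1 := ⟨f - 1, by omega⟩
        obtain ⟨h1, h2⟩ := Prod.ext_iff.1 hbr
        simp only at h1 h2
        obtain ⟨ihxr, ihxd⟩ := ih x hx hxP f (by omega)
        have hlab : lab n k b = lab n k x + 1 := by unfold lab; omega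
        have hbr' : (b.1, b.2 + 1) ∈ D.S.boxes := hbr ▸ hx
        rw [pipeAux, if_pos hbr', hbr, hlab]
        by_cases hpl : D.fill x = Fill.plus
        · rw [if_pos hpl, wordProd_stoneWord_snoc_plus D P hpl, ihxd hxd]
        · rw [if_neg hpl, wordProd_stoneWord_snoc_stone D P hpl, Equiv.Perm.mul_apply,
            ← ihxr hxr]
          simp [sw_apply]
      · have hr' : (b.1, b.2 + 1) ∈ D.S.boxes → (b.1, b.2 + 1) ∈ P := fun h => by
          simpa [hbr] using hr h
        have := e1 _ hr' ⟨le_rfl, Nat.le_succ _⟩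
        have hbr2 : ¬ (b.1 = x.1 ∧ b.2 + 1 = x.2) := fun h => hbr (Prod.ext h.1 h.2)
        rw [← ihr hr']
        by_cases hpl : D.fill x = Fill.plus
        · rw [wordProd_stoneWord_snoc_plus D P hpl]
        · rw [wordProd_stoneWord_snoc_stone D P hpl, Equiv.Perm.mul_apply, sw_apply,
            if_neg, if_neg]
          · unfold lab; simp only at this; omega
          · unfold lab; simp only at this; omega
    · intro hd
      by_cases hbd : (b.1 + 1, b.2) = x
      · obtain ⟨f, rfl⟩ : ∃ g, f = g + 1 := ⟨f - 1, by omega⟩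
        obtain ⟨h1, h2⟩ := Prod.ext_iff.1 hbd
        simp only at h1 h2
        obtain ⟨ihxr, ihxd⟩ := ih x hx hxP f (by omega)
        have hlab : lab n k b + 1 = lab n k x := by unfold lab; omega
        have hbd' : (b.1 + 1, b.2) ∈ D.S.boxes := hbd ▸ hx
        rw [pipeAux, if_pos hbd', hbd, hlab]
        by_cases hpl : D.fill x = Fill.plus
        · rw [if_pos hpl, wordProd_stoneWord_snoc_plus D P hpl, ihxr hxr]
        · rw [if_neg hpl, wordProd_stoneWord_snoc_stone D P hpl, Equiv.Perm.mul_apply,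
            ← ihxd hxd]
          simp [sw_apply]
      · have hd' : (b.1 + 1, b.2) ∈ D.S.boxes → (b.1 + 1, b.2) ∈ P := fun h => by
          simpa [hbd] using hd h
        have := e1 _ hd' ⟨Nat.le_succ _, le_rfl⟩
        have hbd2 : ¬ (b.1 + 1 = x.1 ∧ b.2 = x.2) := fun h => hbd (Prod.ext h.1 h.2)
        rw [← ihd hd']
        by_cases hpl : D.fill x = Fill.plus
        · rw [wordProd_stoneWord_snoc_plus D P hpl]
        · rw [wordProd_stoneWord_snoc_stone D P hpl, Equiv.Perm.mul_apply, sw_apply,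
            if_neg, if_neg]
          · unfold lab; simp only at this; omega
          · unfold lab; simp only at this; omega

/-- The pipes at the next box to be read sit at the two positions of its transposition. -/
theorem IsReading.pipes_eq {n k : ℕ} {D : Diagram n k} {P : List (ℕ × ℕ)}
    (h : IsReading D.S P) {x : ℕ × ℕ} (hx : x ∈ D.S.boxes) (hxP : x ∉ P)
    (hprev : ∀ y ∈ D.S.boxes, inIn x y → y ≠ x → y ∈ P) :
    wordProd (stoneWord D P) (lab n k x) = pipeR D x ∧
      wordProd (stoneWord D P) (lab n k x + 1) = pipeB D x := by
  have h1 := D.S.row_lt x hx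
  have h2 := D.S.col_lt x hx
  obtain ⟨hr, hd⟩ := h.frontier x hx hxP (n + 1) (by omega)
  exact ⟨hr fun h => hprev _ h ⟨le_rfl, Nat.le_succ _⟩ (by simp [Prod.ext_iff]),
    hd fun h => hprev _ h ⟨Nat.le_succ _, le_rfl⟩ (by simp [Prod.ext_iff])⟩

theorem swap_eq_of_pair_eq {a b c d : ℕ} (h : ({a, b} : Finset ℕ) = {c, d}) :
    Equiv.swap a b = Equiv.swap c d := by
  have ha : a ∈ ({c, d} : Finset ℕ) := h ▸ by simp
  have hb : b ∈ ({c, d} : Finset ℕ) := h ▸ by simp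
  have hc : c ∈ ({a, b} : Finset ℕ) := h ▸ by simp
  have hd : d ∈ ({a, b} : Finset ℕ) := h ▸ by simp
  simp only [Finset.mem_insert, Finset.mem_singleton] at ha hb hc hd
  have hor : a = c ∧ b = d ∨ a = d ∧ b = c := by omega
  rcases hor with ⟨rfl, rfl⟩ | ⟨rfl, rfl⟩
  · rfl
  · exact Equiv.swap_comm _ _

/-- Two boxes visited by the same two pipes are comparable. -/
theorem inIn_or_inIn_of_pipePair_eq {n k : ℕ} {D : Diagram n k} {x y : ℕ × ℕ}
    (hx : x ∈ D.S.boxes) (hy : y ∈ D.S.boxes) (hxy : pipePair D x = pipePair D y) :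
    inIn x y ∨ inIn y x := by
  by_contra hcon
  rw [not_or] at hcon
  obtain ⟨hnxy, hnyx⟩ := hcon
  let q : ℕ × ℕ → Bool := fun c => decide ((inIn x c ∨ inIn y c) ∧ c ≠ x ∧ c ≠ y)
  have hP : IsReading D.S ((readingList D.S).filter q) := by
    refine isReading_filter D.S q ?_
    rintro ⟨r, c⟩ - hz ⟨r', c'⟩ - hzz
    obtain ⟨x1, x2⟩ := x
    obtain ⟨y1, y2⟩ := y
    simp only [q, inIn, decide_eq_true_eq, ne_eq, Prod.mk.injEq] at *
    omega
  have hmem (z : ℕ × ℕ) : z ∈ (readingList D.S).filter q ↔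
      z ∈ D.S.boxes ∧ (inIn x z ∨ inIn y z) ∧ z ≠ x ∧ z ≠ y := by
    rw [List.mem_filter, mem_readingList]
    simp [q]
  obtain ⟨hxr, hxb⟩ := hP.pipes_eq hx (by simp [hmem]) fun z hz hxz hne =>
    (hmem z).2 ⟨hz, Or.inl hxz, hne, fun e => hnxy (e ▸ hxz)⟩
  obtain ⟨hyr, hyb⟩ := hP.pipes_eq hy (by simp [hmem]) fun z hz hyz hne =>
    (hmem z).2 ⟨hz, Or.inr hyz, fun e => hnyx (e ▸ hyz), hne⟩
  have hlab : lab n k x = lab n k y := by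
    set u := wordProd (stoneWord D ((readingList D.S).filter q))
    have m1 : pipeB D x ∈ pipePair D y := hxy ▸ by simp [pipePair]
    have m2 : pipeR D x ∈ pipePair D y := hxy ▸ by simp [pipePair]
    simp only [pipePair, Finset.mem_insert, Finset.mem_singleton, ← hxr, ← hxb, ← hyr, ← hyb,
      u.injective.eq_iff] at m1 m2
    omega
  have h1 := D.S.col_lt x hx
  have h2 := D.S.col_lt y hy
  unfold inIn at hnxy hnyx
  unfold lab at hlab
  omega

/-! ### Effect of a corrective flip -/

/-- Reading a stone box transposes the labels of the two pipes at that box. -/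
theorem IsReading.wordProd_mul_sw {n k : ℕ} {D : Diagram n k} {P : List (ℕ × ℕ)}
    (h : IsReading D.S P) {x : ℕ × ℕ} (hx : x ∈ D.S.boxes) (hxP : x ∉ P)
    (hprev : ∀ y ∈ D.S.boxes, inIn x y → y ≠ x → y ∈ P) {α β : ℕ}
    (hpair : pipePair D x = {α, β}) :
    wordProd (stoneWord D P) * sw (lab n k x) =
      Equiv.swap α β * wordProd (stoneWord D P) := by
  obtain ⟨hr, hb⟩ := h.pipes_eq hx hxP hprev
  rw [sw, Equiv.mul_swap_eq_swap_mul, hr, hb, Equiv.swap_comm, swap_eq_of_pair_eq hpair]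

/-- Exchanging a plus and a stone visited by the same two pipes multiplies the product of a
reading by their transposition exactly when one of the two boxes has been read. -/
theorem IsReading.wordProd_exchange {n k : ℕ} {D D' : Diagram n k} {p t : ℕ × ℕ} {α β : ℕ}
    (hpt : p ≠ t) (hpf : D.fill p = Fill.plus) (htf : D.fill t ≠ Fill.plus)
    (hpf' : D'.fill p ≠ Fill.plus) (htf' : D'.fill t = Fill.plus)
    (hother : ∀ c ∈ D.S.boxes, c ≠ p → c ≠ t → (D'.fill c = Fill.plus ↔ D.fill c = Fill.plus))
    (hp : pipePair D p = {α, β}) (ht : pipePair D t = {α, β}) {P : List (ℕ × ℕ)}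
    (h : IsReading D.S P) :
    wordProd (stoneWord D' P) =
      if p ∈ P ↔ t ∈ P then wordProd (stoneWord D P)
      else Equiv.swap α β * wordProd (stoneWord D P) := by
  induction h with
  | nil => simp [stoneWord]
  | snoc P x hP hx hxP hprev ih =>
    by_cases hxp : x = p
    · subst hxp
      have hm : x ∈ P ++ [x] := by simp
      have hmt : t ∈ P ++ [x] ↔ t ∈ P := by simp [hpt.symm]
      rw [wordProd_stoneWord_snoc_stone D' P hpf', wordProd_stoneWord_snoc_plus D P hpf, ih]
      simp only [hm, hxP, hmt, true_iff, false_iff]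
      have := hP.wordProd_mul_sw hx hxP hprev hp
      by_cases htP : t ∈ P
      · simp [htP, mul_assoc, this]
      · simp [htP, this]
    · by_cases hxt : x = t
      · subst hxt
        have hm : x ∈ P ++ [x] := by simp
        have hmt : p ∈ P ++ [x] ↔ p ∈ P := by simp [hpt]
        rw [wordProd_stoneWord_snoc_plus D' P htf', wordProd_stoneWord_snoc_stone D P htf, ih,
          hP.wordProd_mul_sw hx hxP hprev ht]
        simp only [hm, hxP, hmt, iff_true, iff_false]
        by_cases htP : p ∈ P
        · simp [htP]
        · simp [htP]
      · have hm1 : p ∈ P ++ [x] ↔ p ∈ P := by simp [Ne.symm hxp]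
        have hm2 : t ∈ P ++ [x] ↔ t ∈ P := by simp [Ne.symm hxt]
        have ho := hother x hx hxp hxt
        simp only [hm1, hm2]
        by_cases hpl : D.fill x = Fill.plus
        · rw [wordProd_stoneWord_snoc_plus D' P (ho.2 hpl),
            wordProd_stoneWord_snoc_plus D P hpl, ih]
        · rw [wordProd_stoneWord_snoc_stone D' P (mt ho.1 hpl),
            wordProd_stoneWord_snoc_stone D P hpl, ih]
          split_ifs <;> simp [mul_assoc]

/-- Between a crossing `w` and the next meeting `q` of two pipes, these pipes are inverted. -/
theorem IsReading.inverted_of_mem {n k : ℕ} {D : Diagram n k} {w q : ℕ × ℕ}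
    (hwf : D.fill w ≠ Fill.plus) (hcross : pipeR D w < pipeB D w)
    (hq : q ∈ D.S.boxes) (hpair : pipePair D q = pipePair D w)
    (hnext : ∀ d, IsStone D d → pipePair D d = pipePair D w → inIn q d → inIn d w →
      d = w ∨ d = q) {P : List (ℕ × ℕ)} (h : IsReading D.S P) :
    w ∈ P → q ∉ P → (wordProd (stoneWord D P))⁻¹ (pipeB D w) <
      (wordProd (stoneWord D P))⁻¹ (pipeR D w) := by
  induction h with
  | nil => simp
  | snoc P x hP hx hxP hprev ih =>
    intro hw hqP
    rw [List.mem_append, List.mem_singleton, not_or] at hqP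
    obtain ⟨hqP, hqx⟩ := hqP
    obtain ⟨hr, hb⟩ := hP.pipes_eq hx hxP hprev
    set u := wordProd (stoneWord D P) with hu
    by_cases hxw : x = w
    · subst hxw
      rw [wordProd_stoneWord_snoc_stone D P hwf, ← hu, mul_inv_rev, Equiv.Perm.mul_apply,
        Equiv.Perm.mul_apply, ← hr, ← hb, sw, Equiv.swap_inv]
      simp
    · have hwP : w ∈ P := by simpa [Ne.symm hxw] using hw
      have ih := ih hwP hqP
      by_cases hpl : D.fill x = Fill.plus
      · rwa [wordProd_stoneWord_snoc_plus D P hpl]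
      · have hpx : pipePair D x ≠ pipePair D w := by
          intro hpx
          have hxw' : inIn x w :=
            (inIn_or_inIn_of_pipePair_eq hx (hP.mem_boxes hwP) hpx).resolve_right fun hwx =>
              hxP (hP.mem_of_inIn hwP hx hwx)
          have hqx' : inIn q x :=
            (inIn_or_inIn_of_pipePair_eq hq hx (hpair.trans hpx.symm)).resolve_right fun hxq =>
              hqP (hprev q hq hxq hqx)
          rcases hnext x ⟨hx, hpl⟩ hpx hqx' hxw' with e | e
          · exact hxw e
          · exact hqx e.symm
        rw [wordProd_stoneWord_snoc_stone D P hpl, ← hu, mul_inv_rev, Equiv.Perm.mul_apply,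
          Equiv.Perm.mul_apply, sw, Equiv.swap_inv]
        change sw _ _ < sw _ _
        have hne : ¬ (u⁻¹ (pipeB D w) = lab n k x ∧ u⁻¹ (pipeR D w) = lab n k x + 1) := by
          rintro ⟨h1, h2⟩
          rw [Equiv.Perm.inv_eq_iff_eq] at h1 h2
          exact hpx (by rw [pipePair, pipePair, ← hr, ← hb, h1, h2, Finset.pair_comm])
        rw [sw_apply, sw_apply]
        split_ifs <;> omega

theorem pipeAux_setFill {n k : ℕ} (D : Diagram n k) (p : ℕ × ℕ) (a : Fill) (f : ℕ) :
    ∀ (e : Bool) (d : ℕ × ℕ), inIn p d →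
      pipeAux (setFill D p a) f e d = pipeAux D f e d := by
  induction f with
  | zero => intro e d _; rfl
  | succ f ih =>
    rintro e ⟨r, c⟩ ⟨h1, h2⟩
    simp only at h1 h2
    have hd : (r + 1, c) ≠ p := by rintro rfl; simp at h1
    have hr : (r, c + 1) ≠ p := by rintro rfl; simp at h2
    have i1 (e : Bool) := ih e (r + 1, c) ⟨by simp; omega, h2⟩
    have i2 (e : Bool) := ih e (r, c + 1) ⟨h1, by simp; omega⟩
    cases e
    · simp only [pipeAux, i2]
      simp [setFill, hr]
    · simp only [pipeAux, i1]
      simp [setFill, hd]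

theorem pipeB_setFill {n k : ℕ} (D : Diagram n k) {p d : ℕ × ℕ} (a : Fill) (h : inIn p d) :
    pipeB (setFill D p a) d = pipeB D d := pipeAux_setFill D p a _ _ d h

theorem pipeR_setFill {n k : ℕ} (D : Diagram n k) {p d : ℕ × ℕ} (a : Fill) (h : inIn p d) :
    pipeR (setFill D p a) d = pipeR D d := pipeAux_setFill D p a _ _ d h

theorem pipePair_setFill {n k : ℕ} (D : Diagram n k) {p d : ℕ × ℕ} (a : Fill) (h : inIn p d) :
    pipePair (setFill D p a) d = pipePair D d := by
  rw [pipePair, pipePair, pipeB_setFill D a h, pipeR_setFill D a h]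

theorem flipPlusWith_fill_eq_plus_iff {n k : ℕ} (D : Diagram n k) (p t c : ℕ × ℕ) :
    (flipPlusWith D p t).fill c = Fill.plus ↔ c = t ∨ (c ≠ p ∧ D.fill c = Fill.plus) := by
  have hre (E : Diagram n k) : (recolor E).fill c = Fill.plus ↔ E.fill c = Fill.plus := by
    simp only [recolor]
    split_ifs <;> simp_all
  rw [flipPlusWith, hre]
  simp only [setFill]
  split_ifs <;> simp_all

/-- If `D'` is obtained from `D` by a corrective flip, then
`u_{b^in}^{D'} ≤ u_{b^in}^{D}` in the Bruhat order, for every box `b`. -/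
theorem corrective_flip_decreases_uIn {n k : ℕ} (D D' : Diagram n k)
    (hB : BlackIffUncross D) (h : IsCorrectiveFlip D D') :
    ∀ b ∈ D.S.boxes, BruhatLE n (uIn D' b) (uIn D b) := by
  intro b _
  obtain ⟨p, t, ⟨hpS, hpf, -, w, hwp, hwt⟩, hS, hfill⟩ := h
  have hS : D'.S = D.S := hS
  obtain ⟨⟨hwS, hwf⟩, -, hne, hcross, -, hpair, hin, hnext⟩ := hwp
  have hwf : D.fill w ≠ Fill.plus := by simpa [setFill, hne] using hwf
  have hpp : inIn p p := ⟨le_rfl, le_rfl⟩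
  rw [pipeR_setFill D _ hin, pipeB_setFill D _ hin] at hcross
  rw [pipePair_setFill D _ hin, pipePair_setFill D _ hpp] at hpair
  have hnext' (d : ℕ × ℕ) (hd : IsStone D d) (hdw : pipePair D d = pipePair D w)
      (hpd : inIn p d) (hdw' : inIn d w) : d = w ∨ d = p := by
    refine hnext d ⟨hd.1, ?_⟩ ?_ hpd hdw'
    · have : d ≠ p := fun e => hd.2 (e ▸ hpf)
      simpa [setFill, this] using hd.2
    · rw [pipePair_setFill D _ hpd, pipePair_setFill D _ hin, hdw]
  have htS : t ∈ D.S.boxes ∧ D.fill t ≠ Fill.plus ∧ pipePair D t = pipePair D w := by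
    rcases hwt with rfl | hwt
    · exact ⟨hwS, hwf, rfl⟩
    · exact ⟨hwt.2.1.1, hwt.2.1.2, hwt.2.2.2.2.2.1.symm⟩
  obtain ⟨htS, htf, htp⟩ := htS
  have hpt : p ≠ t := fun e => htf (e ▸ hpf)
  have hfill' (c : ℕ × ℕ) (hc : c ∈ D.S.boxes) :
      D'.fill c = Fill.plus ↔ c = t ∨ (c ≠ p ∧ D.fill c = Fill.plus) := by
    rw [hfill c (hS ▸ hc), flipPlusWith_fill_eq_plus_iff]
  have hL := isReading_inList D.S b
  rw [uIn_eq_wordProd, uIn_eq_wordProd, hS,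
    hL.wordProd_exchange (D' := D') (α := pipeR D w) (β := pipeB D w) hpt hpf htf
      (by simp [hfill' p hpS, hpt]) (by simp [hfill' t htS])
      (fun c hc h1 h2 => by simp [hfill' c hc, h1, h2])
      (by rw [← hpair, pipePair, Finset.pair_comm]) (by rw [htp, pipePair, Finset.pair_comm])]
  split_ifs with hiff
  · exact bruhatLE_refl _ (stoneWord_lt D hL)
  · refine bruhatLE_swap_mul _ (stoneWord_lt D hL) hcross ?_
    have hpw : p ∈ inList D.S b → w ∈ inList D.S b := fun h => hL.mem_of_inIn h hwS hin
    rcases hwt with rfl | hwt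
    · exact hL.inverted_of_mem hwf hcross hpS hpair.symm hnext' (by tauto) (by tauto)
    · obtain ⟨-, ht, hwt, -, -, -, htw, htnext⟩ := hwt
      have htp' : inIn t p :=
        (inIn_or_inIn_of_pipePair_eq htS hpS (htp.trans hpair)).resolve_right fun hpt' =>
          (hnext' t ht htp hpt' htw).elim (fun e => hwt e.symm) fun e => hpt e.symm
      have htm : t ∈ inList D.S b → p ∈ inList D.S b := fun h => hL.mem_of_inIn h hpS htp'
      exact hL.inverted_of_mem hwf hcross htS htp htnext (by tauto) (by tauto)

end GoPaper
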